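/- Let F be a finite union closed family of finite sets with |F| ≥ 2. Then there exists an element x that is contained in at least a ψ fraction of the sets of F, where ψ = (3−√5)/2. -/

import Mathlib

namespace UnionClosed

open Real

/-- The golden-ratio conjugate `(√5 - 1) / 2`, the complement of `ψ`. -/
noncomputable def invGolden : ℝ := (√5 - 1) / 2

local notation "γ" => invGolden

lemma invGolden_sq : γ ^ 2 = 1 - γ := by
  have h : √5 ^ 2 = 5 := Real.sq_sqrt (by norm_num)
  unfold invGolden
  linarith

lemma invGolden_gt : 0.618 < γ := by
  have h : (2.236 : ℝ) < √5 := Real.lt_sqrt_of_sq_lt (by norm_num)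
  unfold invGolden
  linarith

lemma invGolden_lt : γ < 0.619 := by
  have h : √5 < (2.238 : ℝ) := (Real.sqrt_lt' (by norm_num)).2 (by norm_num)
  unfold invGolden
  linarith

/-- The numerator of the second derivative of `auxLog`. -/
noncomputable def auxCubic (x : ℝ) : ℝ :=
  2 * (1 - x) ^ 2 - (1 + γ) * (1 - x) * (1 + x) ^ 2 + (1 - γ) * (1 + x) ^ 2

lemma convexOn_auxCubic : ConvexOn ℝ (Set.Ici 0) auxCubic := by
  have h : auxCubic = fun x => (1 + γ) * x ^ 3 + 4 * x ^ 2 + ((-3 * γ - 3) * x + (2 - 2 * γ)) := by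
    funext x
    unfold auxCubic
    ring
  have hq := invGolden_gt
  rw [h]
  refine ((convexOn_pow 3).smul (by linarith : 0 ≤ 1 + γ)).add
    ((convexOn_pow 2).smul (by norm_num : (0 : ℝ) ≤ 4)) |>.add ⟨convex_Ici 0, ?_⟩
  intro x _ y _ a b _ _ hab
  simp only [smul_eq_mul]
  obtain rfl : b = 1 - a := by linarith
  exact le_of_eq (by ring)

/-- A convex function on `[0, 1]` that is positive at the endpoints and negative at `c` is
nonpositive between two points around `c` and nonnegative outside. -/
lemma exists_sign_pattern {P : ℝ → ℝ} {c : ℝ} (hP : ConvexOn ℝ (Set.Icc 0 1) P)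
    (hcont : Continuous P) (hc0 : 0 < c) (hc1 : c < 1) (h0 : 0 < P 0) (hc : P c < 0)
    (h1 : 0 < P 1) :
    ∃ a b, 0 < a ∧ a < c ∧ c < b ∧ b < 1 ∧ (∀ x ∈ Set.Icc 0 a, 0 ≤ P x) ∧
      (∀ x ∈ Set.Icc a b, P x ≤ 0) ∧ ∀ x ∈ Set.Icc b 1, 0 ≤ P x := by
  obtain ⟨a, ⟨ha0, hac⟩, ha⟩ := intermediate_value_Ioo' hc0.le hcont.continuousOn ⟨hc, h0⟩
  obtain ⟨b, ⟨hbc, hb1⟩, hb⟩ := intermediate_value_Ioo hc1.le hcont.continuousOn ⟨hc, h1⟩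
  refine ⟨a, b, ha0, hac, hbc, hb1, ?_, ?_, ?_⟩
  · rintro x ⟨hx0, hxa⟩
    by_contra! hx
    have := hP.le_max_of_mem_Icc (x := x) (y := c) (z := a) ⟨hx0, by linarith⟩
      ⟨hc0.le, hc1.le⟩ ⟨hxa, hac.le⟩
    rw [ha] at this
    exact absurd this (not_le.2 (max_lt hx hc))
  · rintro x hx
    have := hP.le_max_of_mem_Icc (x := a) (y := b) (z := x) ⟨ha0.le, by linarith⟩
      ⟨by linarith, hb1.le⟩ hx
    simpa [ha, hb] using this
  · rintro x ⟨hxb, hx1⟩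
    by_contra! hx
    have := hP.le_max_of_mem_Icc (x := c) (y := x) (z := b) ⟨hc0.le, hc1.le⟩
      ⟨by linarith, hx1⟩ ⟨hbc.le, hxb⟩
    rw [hb] at this
    exact absurd this (not_le.2 (max_lt hc hx))

/-- Up to a factor `-x ^ 3`, the derivative of `entropyGap`. -/
noncomputable def auxLog (x : ℝ) : ℝ := (1 + γ) * x * log (1 - x) - 2 * log (1 - x ^ 2)

lemma auxLog_zero : auxLog 0 = 0 := by simp [auxLog]

lemma auxLog_invGolden : auxLog γ = 0 := by
  have h : log (1 - γ) = 2 * log γ := by rw [← invGolden_sq, log_pow]; norm_num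
  rw [auxLog, invGolden_sq, h, sub_sub_cancel]
  linear_combination 2 * log γ * invGolden_sq

/-- The derivative of `auxLog`. -/
noncomputable def auxLogDeriv (x : ℝ) : ℝ :=
  (1 + γ) * log (1 - x) - (1 + γ) * x / (1 - x) + 4 * x / (1 - x ^ 2)

lemma hasDerivAt_auxLog {x : ℝ} (h0 : -1 < x) (h1 : x < 1) :
    HasDerivAt auxLog (auxLogDeriv x) x := by
  have hx : 1 - x ≠ 0 := by linarith
  have hx2 : 1 - x ^ 2 ≠ 0 := by nlinarith
  have d1 := ((hasDerivAt_id x).const_sub 1).log hx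
  have d2 := (((hasDerivAt_id x).pow 2).const_sub 1).log hx2
  refine ((((hasDerivAt_id x).const_mul (1 + γ)).mul d1).sub (d2.const_mul 2)).congr_deriv ?_
  simp [auxLogDeriv]
  field_simp
  ring

lemma hasDerivAt_auxLogDeriv {x : ℝ} (h0 : -1 < x) (h1 : x < 1) :
    HasDerivAt auxLogDeriv (auxCubic x / ((1 - x) ^ 2 * (1 + x) ^ 2)) x := by
  have hx : 1 - x ≠ 0 := by linarith
  have hx' : 1 + x ≠ 0 := by linarith
  have hx2 : 1 - x ^ 2 ≠ 0 := by nlinarith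
  have d1 := ((hasDerivAt_id x).const_sub 1).log hx
  have d2 := ((hasDerivAt_id x).const_mul (1 + γ)).div ((hasDerivAt_id x).const_sub 1) hx
  have d3 := ((hasDerivAt_id x).const_mul 4).div (((hasDerivAt_id x).pow 2).const_sub 1) hx2
  refine (((d1.const_mul (1 + γ)).sub d2).add d3).congr_deriv ?_
  simp [auxCubic]
  rw [show 1 - x ^ 2 = (1 - x) * (1 + x) by ring]
  field_simp
  ring

lemma convexOn_auxLog {a b : ℝ} (ha : 0 ≤ a) (hb : b < 1) (h : ∀ x ∈ Set.Icc a b, 0 ≤ auxCubic x) :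
    ConvexOn ℝ (Set.Icc a b) auxLog := by
  refine convexOn_of_hasDerivWithinAt2_nonneg (convex_Icc a b) (f' := auxLogDeriv)
    (f'' := fun x => auxCubic x / ((1 - x) ^ 2 * (1 + x) ^ 2)) ?_ ?_ ?_ ?_
  · exact fun x hx => (hasDerivAt_auxLog (by linarith [hx.1])
      (by linarith [hx.2])).continuousAt.continuousWithinAt
  all_goals intro x hx; replace hx := interior_subset hx
  · exact (hasDerivAt_auxLog (by linarith [hx.1]) (by linarith [hx.2])).hasDerivWithinAt
  · exact (hasDerivAt_auxLogDeriv (by linarith [hx.1]) (by linarith [hx.2])).hasDerivWithinAt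
  · have := h x hx
    positivity

lemma concaveOn_auxLog {a b : ℝ} (ha : 0 ≤ a) (hb : b < 1)
    (h : ∀ x ∈ Set.Icc a b, auxCubic x ≤ 0) : ConcaveOn ℝ (Set.Icc a b) auxLog := by
  refine concaveOn_of_hasDerivWithinAt2_nonpos (convex_Icc a b) (f' := auxLogDeriv)
    (f'' := fun x => auxCubic x / ((1 - x) ^ 2 * (1 + x) ^ 2)) ?_ ?_ ?_ ?_
  · exact fun x hx => (hasDerivAt_auxLog (by linarith [hx.1])
      (by linarith [hx.2])).continuousAt.continuousWithinAt
  all_goals intro x hx; replace hx := interior_subset hx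
  · exact (hasDerivAt_auxLog (by linarith [hx.1]) (by linarith [hx.2])).hasDerivWithinAt
  · exact (hasDerivAt_auxLogDeriv (by linarith [hx.1]) (by linarith [hx.2])).hasDerivWithinAt
  · exact div_nonpos_of_nonpos_of_nonneg (h x hx) (by positivity)

lemma exists_auxCubic_sign_pattern :
    ∃ a b, 0 < a ∧ a < γ ∧ γ < b ∧ b < 1 ∧ (∀ x ∈ Set.Icc 0 a, 0 ≤ auxCubic x) ∧
      (∀ x ∈ Set.Icc a b, auxCubic x ≤ 0) ∧ ∀ x ∈ Set.Icc b 1, 0 ≤ auxCubic x := by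
  have hq := invGolden_gt
  have hq' := invGolden_lt
  refine exists_sign_pattern (convexOn_auxCubic.subset Set.Icc_subset_Ici_self (convex_Icc _ _))
    (by unfold auxCubic; fun_prop) (by linarith) (by linarith) ?_ ?_ ?_
  · norm_num [auxCubic]; linarith
  · have h : auxCubic γ = 4 - 7 * γ := by
      unfold auxCubic
      linear_combination (γ ^ 2 + 2) * invGolden_sq
    linarith
  · norm_num [auxCubic]; linarith


lemma auxLog_nonneg_left {x : ℝ} (h0 : 0 ≤ x) (hx : x ≤ γ) : 0 ≤ auxLog x := by
  obtain ⟨a, b, ha0, haγ, hγb, hb1, h₁, h₂, -⟩ := exists_auxCubic_sign_pattern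
  have hconv := convexOn_auxLog le_rfl (by linarith) h₁
  have hleft : ∀ y ∈ Set.Icc 0 a, 0 ≤ auxLog y := by
    rintro y ⟨hy0, hya⟩
    rcases hy0.eq_or_lt with rfl | hy0
    · exact auxLog_zero.ge
    have h := hconv.le_slope_of_hasDerivAt ⟨le_rfl, ha0.le⟩ ⟨hy0.le, hya⟩ hy0
      (hasDerivAt_auxLog (by norm_num) (by norm_num))
    rw [slope_def_field, auxLog_zero, show auxLogDeriv 0 = 0 by simp [auxLogDeriv], sub_zero,
      sub_zero, le_div_iff₀ hy0, zero_mul] at h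
    exact h
  rcases le_total x a with hxa | hax
  · exact hleft x ⟨h0, hxa⟩
  · have h := (concaveOn_auxLog ha0.le hb1 h₂).min_le_of_mem_Icc (x := a) (y := γ) (z := x)
      ⟨le_rfl, by linarith⟩ ⟨haγ.le, hγb.le⟩ ⟨hax, hx⟩
    rw [auxLog_invGolden, min_eq_right (hleft a ⟨ha0.le, le_rfl⟩)] at h
    exact h

/-- To the right of `γ`, `auxLog` is nonpositive up to a point and nonnegative afterwards. -/
lemma auxLog_sign_right {y : ℝ} (hγy : γ ≤ y) (hy1 : y < 1) :
    (∀ x ∈ Set.Icc γ y, auxLog x ≤ 0) ∨ ∀ x ∈ Set.Ico y 1, 0 ≤ auxLog x := by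
  obtain ⟨a, b, ha0, haγ, hγb, hb1, h₁, h₂, h₃⟩ := exists_auxCubic_sign_pattern
  have hγ := auxLog_invGolden
  have hmid : ∀ x ∈ Set.Icc γ b, auxLog x ≤ 0 := by
    rintro x ⟨hx, hxb⟩
    have hxa : 0 < x - a := by linarith
    have hw : 0 < (γ - a) / (x - a) := div_pos (by linarith) hxa
    have h := (concaveOn_auxLog ha0.le hb1 h₂).2 (⟨le_rfl, by linarith⟩ : a ∈ Set.Icc a b)
      (⟨by linarith, hxb⟩ : x ∈ Set.Icc a b)
      (div_nonneg (by linarith) hxa.le : 0 ≤ (x - γ) / (x - a)) hw.le (by field_simp; ring)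
    have hcomb : (x - γ) / (x - a) * a + (γ - a) / (x - a) * x = γ := by field_simp; ring
    simp only [smul_eq_mul, hcomb, hγ] at h
    have := mul_nonneg (div_nonneg (by linarith) hxa.le : 0 ≤ (x - γ) / (x - a))
      (auxLog_nonneg_left ha0.le haγ.le)
    exact nonpos_of_mul_nonpos_right (by linarith) hw
  have hconv : ∀ c < 1, ConvexOn ℝ (Set.Icc b c) auxLog := fun c hc =>
    convexOn_auxLog (by linarith) hc fun x hx => h₃ x ⟨hx.1, by linarith [hx.2]⟩
  have hb : auxLog b ≤ 0 := hmid b ⟨hγb.le, le_rfl⟩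
  by_cases hy : auxLog y ≤ 0
  · left
    rintro x ⟨hγx, hxy⟩
    rcases le_total x b with hxb | hbx
    · exact hmid x ⟨hγx, hxb⟩
    · exact ((hconv y hy1).le_max_of_mem_Icc ⟨le_rfl, hbx.trans hxy⟩ ⟨hbx.trans hxy, le_rfl⟩
        ⟨hbx, hxy⟩).trans (max_le hb hy)
  · right
    rintro x ⟨hyx, hx1⟩
    by_contra! hx
    have hby : b ≤ y := by
      by_contra! h
      exact hy (hmid y ⟨hγy, h.le⟩)
    exact hy (((hconv x hx1).le_max_of_mem_Icc ⟨le_rfl, hby.trans hyx⟩ ⟨hby.trans hyx, le_rfl⟩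
        ⟨hby, hyx⟩).trans (max_le hb hx.le))

/-- The ratio of binary entropy to its argument. -/
noncomputable def entropyRatio (x : ℝ) : ℝ := binEntropy x / x

lemma continuousAt_entropyRatio {x : ℝ} (hx : x ≠ 0) : ContinuousAt entropyRatio x :=
  binEntropy_continuous.continuousAt.div continuousAt_id hx

lemma hasDerivAt_entropyRatio {x : ℝ} (h0 : x ≠ 0) (h1 : x ≠ 1) :
    HasDerivAt entropyRatio (log (1 - x) / x ^ 2) x := by
  refine ((hasDerivAt_binEntropy h0 h1).div (hasDerivAt_id x) h0).congr_deriv ?_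
  simp only [id, binEntropy_eq_negMulLog_add_negMulLog_one_sub, negMulLog]
  ring

/-- The difference of the two sides of Boppana's inequality, divided by `x ^ 2`. -/
noncomputable def entropyGap (x : ℝ) : ℝ := entropyRatio (x ^ 2) - (1 + γ) * entropyRatio x

lemma continuousAt_entropyGap {x : ℝ} (hx : x ≠ 0) : ContinuousAt entropyGap x :=
  (ContinuousAt.comp (f := fun y : ℝ => y ^ 2) (continuousAt_entropyRatio (pow_ne_zero 2 hx))
    (continuousAt_id.pow 2)).sub (continuousAt_const.mul (continuousAt_entropyRatio hx))

lemma hasDerivAt_entropyGap {x : ℝ} (h0 : 0 < x) (h1 : x < 1) :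
    HasDerivAt entropyGap (-(auxLog x / x ^ 3)) x := by
  have h := (hasDerivAt_entropyRatio (pow_ne_zero 2 h0.ne')
    (pow_lt_one₀ h0.le h1 two_ne_zero).ne).comp (h := fun y : ℝ => y ^ 2) x
    (hasDerivAt_pow 2 x)
  refine (h.sub ((hasDerivAt_entropyRatio h0.ne' h1.ne).const_mul (1 + γ))).congr_deriv ?_
  simp only [auxLog]
  field_simp
  simp
  ring

lemma entropyGap_one : entropyGap 1 = 0 := by simp [entropyGap, entropyRatio]

lemma entropyGap_invGolden : entropyGap γ = 0 := by
  have hγ : 0 < γ := by linarith [invGolden_gt]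
  have h : 1 - γ ≠ 0 := by linarith [invGolden_lt]
  rw [entropyGap, entropyRatio, entropyRatio, invGolden_sq, binEntropy_one_sub]
  field_simp
  linear_combination binEntropy γ * invGolden_sq

lemma antitoneOn_entropyGap {s t : ℝ} (hs : 0 < s) (ht : t ≤ 1)
    (h : ∀ x ∈ Set.Ioo s t, 0 ≤ auxLog x) : AntitoneOn entropyGap (Set.Icc s t) := by
  refine antitoneOn_of_hasDerivWithinAt_nonpos (convex_Icc s t)
    (f' := fun x => -(auxLog x / x ^ 3)) ?_ ?_ ?_
  · exact fun x hx => (continuousAt_entropyGap (by linarith [hx.1])).continuousWithinAt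
  all_goals intro x hx; rw [interior_Icc] at hx
  · exact (hasDerivAt_entropyGap (by linarith [hx.1]) (by linarith [hx.2])).hasDerivWithinAt
  · have h₁ := h x hx
    have h₂ : 0 < x := by linarith [hx.1]
    exact neg_nonpos.2 (by positivity)

lemma monotoneOn_entropyGap {s t : ℝ} (hs : 0 < s) (ht : t ≤ 1)
    (h : ∀ x ∈ Set.Ioo s t, auxLog x ≤ 0) : MonotoneOn entropyGap (Set.Icc s t) := by
  refine monotoneOn_of_hasDerivWithinAt_nonneg (convex_Icc s t)
    (f' := fun x => -(auxLog x / x ^ 3)) ?_ ?_ ?_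
  · exact fun x hx => (continuousAt_entropyGap (by linarith [hx.1])).continuousWithinAt
  all_goals intro x hx; rw [interior_Icc] at hx
  · exact (hasDerivAt_entropyGap (by linarith [hx.1]) (by linarith [hx.2])).hasDerivWithinAt
  · have h₂ : 0 < x := by linarith [hx.1]
    exact neg_nonneg.2 (div_nonpos_of_nonpos_of_nonneg (h x hx) (by positivity))

/-- **Boppana's inequality**: `φ x h(x) ≤ h(x²)`, with `φ` the golden ratio. -/
lemma entropyGap_nonneg {x : ℝ} (h0 : 0 < x) (h1 : x ≤ 1) : 0 ≤ entropyGap x := by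
  have hγ0 := invGolden_gt
  rcases le_total x γ with hx | hx
  · rw [← entropyGap_invGolden]
    refine antitoneOn_entropyGap h0 (by linarith [invGolden_lt]) (fun y hy => ?_)
      ⟨le_rfl, hx⟩ ⟨hx, le_rfl⟩ hx
    exact auxLog_nonneg_left (by linarith [hy.1]) hy.2.le
  rcases h1.eq_or_lt with rfl | h1
  · exact entropyGap_one.ge
  rcases auxLog_sign_right hx h1 with h | h
  · rw [← entropyGap_invGolden]
    exact monotoneOn_entropyGap (by linarith) h1.le (fun y hy => h y ⟨hy.1.le, hy.2.le⟩)
      ⟨le_rfl, hx⟩ ⟨hx, le_rfl⟩ hx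
  · rw [← entropyGap_one]
    exact antitoneOn_entropyGap h0 le_rfl (fun y hy => h y ⟨hy.1.le, hy.2⟩)
      ⟨le_rfl, h1.le⟩ ⟨h1.le, le_rfl⟩ h1.le

lemma log_one_sub_div_antitone {x y : ℝ} (hx : 0 < x) (hxy : x ≤ y) (hy : y < 1) :
    log (1 - y) / y ≤ log (1 - x) / x := by
  have hy0 := hx.trans_le hxy
  have h := strictConcaveOn_log_Ioi.concaveOn.2 (by simpa using hy : 1 - y ∈ Set.Ioi 0)
    (by simp : (1 : ℝ) ∈ Set.Ioi 0) (by positivity : 0 ≤ x / y)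
    (sub_nonneg.2 ((div_le_one hy0).2 hxy)) (by ring)
  simp only [smul_eq_mul, log_one, mul_zero, add_zero, mul_one] at h
  rw [show x / y * (1 - y) + (1 - x / y) = 1 - x by field_simp; ring] at h
  rw [le_div_iff₀ hx]
  exact (by ring : _ = x / y * log (1 - y)).trans_le h

lemma concaveOn_entropyRatio_exp : ConcaveOn ℝ (Set.Ici 0) fun s => entropyRatio (exp (-s)) := by
  have hd : ∀ s ∈ interior (Set.Ici (0 : ℝ)), HasDerivAt (fun s => entropyRatio (exp (-s)))
      (-(log (1 - exp (-s)) / exp (-s))) s := by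
    intro s hs
    rw [interior_Ici] at hs
    have h1 : exp (-s) ≠ 1 := (exp_lt_one_iff.2 (neg_lt_zero.2 hs)).ne
    refine ((hasDerivAt_entropyRatio (exp_ne_zero _) h1).comp s
      (hasDerivAt_neg s).exp).congr_deriv ?_
    field_simp
  refine AntitoneOn.concaveOn_of_deriv (convex_Ici 0) ?_
    (fun s hs => (hd s hs).differentiableAt.differentiableWithinAt) ?_
  · exact fun s _ => (ContinuousAt.comp (f := fun s : ℝ => exp (-s))
      (continuousAt_entropyRatio (exp_ne_zero _)) (by fun_prop)).continuousWithinAt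
  · intro s hs t ht hst
    rw [(hd s hs).deriv, (hd t ht).deriv]
    rw [interior_Ici] at hs
    exact neg_le_neg (log_one_sub_div_antitone (exp_pos _) (exp_le_exp.2 (neg_le_neg hst))
      (exp_lt_one_iff.2 (neg_lt_zero.2 hs)))

lemma entropyRatio_mul_ge {x y : ℝ} (hx0 : 0 < x) (hx1 : x ≤ 1) (hy0 : 0 < y) (hy1 : y ≤ 1) :
    (1 + γ) / 2 * (entropyRatio x + entropyRatio y) ≤ entropyRatio (x * y) := by
  have h := concaveOn_entropyRatio_exp.2
    (Set.mem_Ici.2 (neg_nonneg.2 (log_nonpos hx0.le hx1)))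
    (Set.mem_Ici.2 (neg_nonneg.2 (log_nonpos hy0.le hy1)))
    (by norm_num : (0 : ℝ) ≤ 1 / 2) (by norm_num : (0 : ℝ) ≤ 1 / 2) (by norm_num)
  simp only [smul_eq_mul, neg_neg, exp_log hx0, exp_log hy0] at h
  set z := exp (-(1 / 2 * -log x + 1 / 2 * -log y)) with hz
  have hz2 : z ^ 2 = x * y := by
    rw [hz, ← exp_nat_mul]
    rw [← exp_log (mul_pos hx0 hy0), log_mul hx0.ne' hy0.ne']
    congr 1
    push_cast
    ring
  have hz1 : z ≤ 1 := by
    refine (sq_le_one_iff₀ (exp_pos _).le).1 ?_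
    rw [hz2]
    exact mul_le_one₀ hx1 hy0.le hy1
  have hgap := entropyGap_nonneg (exp_pos _) hz1
  rw [entropyGap, hz2] at hgap
  nlinarith [invGolden_gt]

/-- The two-variable form of Boppana's inequality. -/
lemma binEntropy_mul_ge {x y : ℝ} (hx0 : 0 ≤ x) (hx1 : x ≤ 1) (hy0 : 0 ≤ y) (hy1 : y ≤ 1) :
    (1 + γ) / 2 * (x * binEntropy y + y * binEntropy x) ≤ binEntropy (x * y) := by
  rcases hx0.eq_or_lt with rfl | hx0
  · simp
  rcases hy0.eq_or_lt with rfl | hy0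
  · simp
  have h := mul_le_mul_of_nonneg_right (entropyRatio_mul_ge hx0 hx1 hy0 hy1)
    (mul_pos hx0 hy0).le
  unfold entropyRatio at h
  rw [div_mul_cancel₀ _ (mul_pos hx0 hy0).ne'] at h
  refine le_of_eq_of_le ?_ h
  field_simp
  ring


/-- The entropy, scaled by `a + b`, of the two-point distribution proportional to `(a, b)`. -/
noncomputable def splitEntropy (a b : ℝ) : ℝ := negMulLog a + negMulLog b - negMulLog (a + b)

lemma splitEntropy_mul (t a b : ℝ) : splitEntropy (t * a) (t * b) = t * splitEntropy a b := by
  simp only [splitEntropy, ← mul_add, negMulLog_mul]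
  ring

lemma splitEntropy_one_sub (x : ℝ) : splitEntropy x (1 - x) = binEntropy x := by
  simp [splitEntropy, binEntropy_eq_negMulLog_add_negMulLog_one_sub]

/-- Every pair of nonnegative reals is a scaled two-point distribution. -/
lemma exists_eq_mul_one_sub {a b : ℝ} (ha : 0 ≤ a) (hb : 0 ≤ b) :
    ∃ x, 0 ≤ x ∧ x ≤ 1 ∧ a = (a + b) * x ∧ b = (a + b) * (1 - x) := by
  rcases (add_nonneg ha hb).eq_or_lt with h | h
  · exact ⟨0, le_rfl, zero_le_one, by linarith, by linarith⟩
  · refine ⟨a / (a + b), by positivity, (div_le_one h).2 (by linarith), ?_, ?_⟩ <;> field_simp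
    ring

lemma splitEntropy_nonneg {a b : ℝ} (ha : 0 ≤ a) (hb : 0 ≤ b) : 0 ≤ splitEntropy a b := by
  obtain ⟨x, hx0, hx1, hax, hbx⟩ := exists_eq_mul_one_sub ha hb
  have hs : 0 ≤ a + b := by positivity
  generalize a + b = s at *
  subst hax hbx
  rw [splitEntropy_mul, splitEntropy_one_sub]
  exact mul_nonneg hs (binEntropy_nonneg hx0 hx1)

lemma splitEntropy_add_le {a b c d : ℝ} (ha : 0 ≤ a) (hb : 0 ≤ b) (hc : 0 ≤ c) (hd : 0 ≤ d) :
    splitEntropy a b + splitEntropy c d ≤ splitEntropy (a + c) (b + d) := by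
  obtain ⟨x, hx0, hx1, hax, hbx⟩ := exists_eq_mul_one_sub ha hb
  obtain ⟨y, hy0, hy1, hcy, hdy⟩ := exists_eq_mul_one_sub hc hd
  have hs : 0 ≤ a + b := by positivity
  have ht : 0 ≤ c + d := by positivity
  generalize a + b = s at *
  generalize c + d = t at *
  subst hax hbx hcy hdy
  rcases (add_nonneg hs ht).eq_or_lt with h | h
  · obtain rfl : s = 0 := by linarith
    obtain rfl : t = 0 := by linarith
    simp [splitEntropy]
  have hconc := strictConcave_binEntropy.concaveOn.2 ⟨hx0, hx1⟩ ⟨hy0, hy1⟩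
    (div_nonneg hs h.le) (div_nonneg ht h.le) (by field_simp)
  simp only [smul_eq_mul] at hconc
  set z := s / (s + t) * x + t / (s + t) * y with hz
  have h1 : s * x + t * y = (s + t) * z := by rw [hz]; field_simp
  have h2 : s * (1 - x) + t * (1 - y) = (s + t) * (1 - z) := by linear_combination -h1
  rw [h1, h2]
  simp only [splitEntropy_mul, splitEntropy_one_sub]
  refine le_of_eq_of_le ?_ (mul_le_mul_of_nonneg_left hconc h.le)
  field_simp

lemma sum_splitEntropy_le {ι : Type*} (s : Finset ι) {f g : ι → ℝ} (hf : ∀ i ∈ s, 0 ≤ f i)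
    (hg : ∀ i ∈ s, 0 ≤ g i) :
    ∑ i ∈ s, splitEntropy (f i) (g i) ≤ splitEntropy (∑ i ∈ s, f i) (∑ i ∈ s, g i) := by
  classical
  induction s using Finset.induction_on with
  | empty => simp [splitEntropy]
  | insert j s hj ih =>
    rw [Finset.forall_mem_insert] at hf hg
    simp only [Finset.sum_insert hj]
    exact (add_le_add_right (ih hf.2 hg.2) _).trans (splitEntropy_add_le hf.1 hg.1
      (Finset.sum_nonneg hf.2) (Finset.sum_nonneg hg.2))

/-- The homogeneous form of the two-variable Boppana inequality. -/
lemma splitEntropy_mul_ge {a b c d : ℝ} (ha : 0 ≤ a) (hb : 0 ≤ b) (hc : 0 ≤ c) (hd : 0 ≤ d) :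
    (1 + γ) / 2 * (a * splitEntropy c d + c * splitEntropy a b) ≤
      splitEntropy (a * c) ((a + b) * (c + d) - a * c) := by
  obtain ⟨x, hx0, hx1, hax, hbx⟩ := exists_eq_mul_one_sub ha hb
  obtain ⟨y, hy0, hy1, hcy, hdy⟩ := exists_eq_mul_one_sub hc hd
  have hs : 0 ≤ a + b := by positivity
  have ht : 0 ≤ c + d := by positivity
  generalize a + b = s at *
  generalize c + d = t at *
  subst hax hbx hcy hdy
  rw [show s * x * (t * y) = s * t * (x * y) by ring,
    show s * t - s * t * (x * y) = s * t * (1 - x * y) by ring]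
  simp only [splitEntropy_mul, splitEntropy_one_sub]
  refine le_of_eq_of_le ?_
    (mul_le_mul_of_nonneg_left (binEntropy_mul_ge hx0 hx1 hy0 hy1) (mul_nonneg hs ht))
  ring

section Mass

variable {ι α : Type*} [DecidableEq α]

/-- The mass of the event that the random set `X`, with weights `w` on `s`, has trace `T`
on `S`. -/
def mass (s : Finset ι) (w : ι → ℝ) (X : ι → Finset α) (S T : Finset α) : ℝ :=
  ∑ j ∈ s with X j ∩ S = T, w j

/-- The Shannon entropy of the trace on `S` of the random set `X`. -/
noncomputable def traceEntropy (s : Finset ι) (w : ι → ℝ) (X : ι → Finset α) (S : Finset α) : ℝ :=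
  ∑ T ∈ S.powerset, negMulLog (mass s w X S T)

variable (s : Finset ι) (w : ι → ℝ) (X : ι → Finset α)

lemma mass_nonneg {w : ι → ℝ} (hw : ∀ j, 0 ≤ w j) (S T : Finset α) : 0 ≤ mass s w X S T :=
  Finset.sum_nonneg fun j _ => hw j

lemma sum_mass (S : Finset α) : ∑ T ∈ S.powerset, mass s w X S T = ∑ j ∈ s, w j :=
  Finset.sum_fiberwise_of_maps_to
    (fun _ _ => Finset.mem_powerset.2 Finset.inter_subset_right) w

lemma mass_filter_add (p : ι → Prop) [DecidablePred p] (S T : Finset α) :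
    mass (s.filter fun j => ¬p j) w X S T + mass (s.filter p) w X S T = mass s w X S T := by
  simp only [mass, Finset.filter_filter]
  rw [add_comm, ← Finset.sum_filter_add_sum_filter_not (s.filter fun j => X j ∩ S = T) p]
  simp only [Finset.filter_filter, and_comm]

lemma mass_insert_of_notMem {i : α} {S T : Finset α} (hT : T ⊆ S) (hi : i ∉ S) :
    mass s w X (insert i S) T = mass (s.filter fun j => ¬i ∈ X j) w X S T := by
  simp only [mass, Finset.filter_filter]
  refine Finset.sum_congr (Finset.filter_congr fun j _ => ?_) fun _ _ => rfl
  by_cases h : i ∈ X j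
  · simp only [h, not_true_eq_false, false_and, iff_false]
    rintro rfl
    exact hi (hT (by simp [h]))
  · simp [h, Finset.inter_insert_of_notMem h]

lemma mass_insert_of_mem {i : α} {S T : Finset α} (hT : T ⊆ S) (hi : i ∉ S) :
    mass s w X (insert i S) (insert i T) = mass (s.filter fun j => i ∈ X j) w X S T := by
  simp only [mass, Finset.filter_filter]
  refine Finset.sum_congr (Finset.filter_congr fun j _ => ?_) fun _ _ => rfl
  by_cases h : i ∈ X j
  · have h1 : i ∉ X j ∩ S := fun h' => hi (Finset.mem_inter.1 h').2
    have h2 : i ∉ T := fun h' => hi (hT h')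
    simp only [h, true_and, Finset.inter_insert_of_mem h]
    refine ⟨fun h' => ?_, fun h' => by rw [h']⟩
    rw [← Finset.erase_insert h1, h', Finset.erase_insert h2]
  · simp only [h, false_and, iff_false]
    intro h'
    have : i ∈ X j ∩ insert i S := h' ▸ Finset.mem_insert_self i T
    exact h (Finset.mem_inter.1 this).1

/-- The chain rule for the trace entropy. -/
lemma traceEntropy_insert {i : α} {S : Finset α} (hi : i ∉ S) :
    traceEntropy s w X (insert i S) = traceEntropy s w X S +
      ∑ T ∈ S.powerset, splitEntropy (mass (s.filter fun j => ¬i ∈ X j) w X S T)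
        (mass (s.filter fun j => i ∈ X j) w X S T) := by
  rw [traceEntropy, Finset.sum_powerset_insert hi, traceEntropy, ← Finset.sum_add_distrib,
    ← Finset.sum_add_distrib]
  refine Finset.sum_congr rfl fun T hT => ?_
  rw [Finset.mem_powerset] at hT
  rw [mass_insert_of_notMem s w X hT hi, mass_insert_of_mem s w X hT hi, splitEntropy,
    mass_filter_add]
  ring

/-- The trace of the union of two independent copies of `X`. -/
lemma mass_union (S T : Finset α) :
    mass (s ×ˢ s) (fun p => w p.1 * w p.2) (fun p => X p.1 ∪ X p.2) S T =
      ∑ P ∈ S.powerset ×ˢ S.powerset with P.1 ∪ P.2 = T,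
        mass s w X S P.1 * mass s w X S P.2 := by
  rw [mass, ← Finset.sum_fiberwise_of_maps_to (g := fun p : ι × ι => (X p.1 ∩ S, X p.2 ∩ S))
    (t := (S.powerset ×ˢ S.powerset).filter fun P => P.1 ∪ P.2 = T)]
  · refine Finset.sum_congr rfl fun P hP => ?_
    rw [mass, mass, Finset.sum_mul_sum, ← Finset.sum_product', ← Finset.filter_product,
      Finset.filter_filter]
    refine Finset.sum_congr (Finset.filter_congr fun p _ => ?_) fun _ _ => rfl
    rw [← (Finset.mem_filter.1 hP).2, Finset.union_inter_distrib_right, Prod.ext_iff]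
    exact ⟨fun h => h.2, fun h => ⟨by rw [h.1, h.2], h⟩⟩
  · intro p hp
    simp [← (Finset.mem_filter.1 hp).2, Finset.union_inter_distrib_right]

lemma sum_splitEntropy_union_ge {w : ι → ℝ} (hw : ∀ j, 0 ≤ w j) (i : α) (S : Finset α) :
    (1 + γ) * (∑ j ∈ s with ¬i ∈ X j, w j) *
      ∑ T ∈ S.powerset, splitEntropy (mass (s.filter fun j => ¬i ∈ X j) w X S T)
        (mass (s.filter fun j => i ∈ X j) w X S T) ≤
      ∑ T ∈ S.powerset, splitEntropy
        (mass ((s ×ˢ s).filter fun p => ¬i ∈ X p.1 ∪ X p.2) (fun p => w p.1 * w p.2)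
          (fun p => X p.1 ∪ X p.2) S T)
        (mass ((s ×ˢ s).filter fun p => i ∈ X p.1 ∪ X p.2) (fun p => w p.1 * w p.2)
          (fun p => X p.1 ∪ X p.2) S T) := by
  set m₀ := mass (s.filter fun j => ¬i ∈ X j) w X S with hm₀
  set m₁ := mass (s.filter fun j => i ∈ X j) w X S with hm₁
  have h₀ : ∀ T, 0 ≤ m₀ T := mass_nonneg _ X hw S
  have h₁ : ∀ T, 0 ≤ m₁ T := mass_nonneg _ X hw S
  have hunion₀ : ∀ T, mass ((s ×ˢ s).filter fun p => ¬i ∈ X p.1 ∪ X p.2)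
      (fun p => w p.1 * w p.2) (fun p => X p.1 ∪ X p.2) S T =
      ∑ P ∈ S.powerset ×ˢ S.powerset with P.1 ∪ P.2 = T, m₀ P.1 * m₀ P.2 := by
    intro T
    rw [hm₀, ← mass_union, ← Finset.filter_product]
    simp only [Finset.mem_union, not_or]
  have hunion₁ : ∀ T, mass ((s ×ˢ s).filter fun p => i ∈ X p.1 ∪ X p.2)
      (fun p => w p.1 * w p.2) (fun p => X p.1 ∪ X p.2) S T =
      ∑ P ∈ S.powerset ×ˢ S.powerset with P.1 ∪ P.2 = T,
        ((m₀ P.1 + m₁ P.1) * (m₀ P.2 + m₁ P.2) - m₀ P.1 * m₀ P.2) := by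
    intro T
    rw [Finset.sum_sub_distrib, ← hunion₀, eq_sub_iff_add_eq', mass_filter_add, mass_union]
    simp only [hm₀, hm₁, mass_filter_add]
  simp only [hunion₀, hunion₁]
  rw [← sum_mass _ w X S, ← hm₀]
  calc _ = ∑ P ∈ S.powerset ×ˢ S.powerset, (1 + γ) / 2 *
        (m₀ P.1 * splitEntropy (m₀ P.2) (m₁ P.2) + m₀ P.2 * splitEntropy (m₀ P.1) (m₁ P.1)) := by
        rw [← Finset.mul_sum, Finset.sum_add_distrib, Finset.sum_product,
          Finset.sum_product_right]
        simp only [← Finset.mul_sum, ← Finset.sum_mul]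
        ring
    _ ≤ ∑ P ∈ S.powerset ×ˢ S.powerset, splitEntropy (m₀ P.1 * m₀ P.2)
        ((m₀ P.1 + m₁ P.1) * (m₀ P.2 + m₁ P.2) - m₀ P.1 * m₀ P.2) :=
        Finset.sum_le_sum fun P _ =>
          splitEntropy_mul_ge (h₀ P.1) (h₁ P.1) (h₀ P.2) (h₁ P.2)
    _ = ∑ T ∈ S.powerset, ∑ P ∈ S.powerset ×ˢ S.powerset with P.1 ∪ P.2 = T,
        splitEntropy (m₀ P.1 * m₀ P.2)
          ((m₀ P.1 + m₁ P.1) * (m₀ P.2 + m₁ P.2) - m₀ P.1 * m₀ P.2) := by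
        refine (Finset.sum_fiberwise_of_maps_to (fun P hP => ?_) _).symm
        simp only [Finset.mem_product, Finset.mem_powerset] at hP ⊢
        exact Finset.union_subset hP.1 hP.2
    _ ≤ _ := by
        refine Finset.sum_le_sum fun T _ => sum_splitEntropy_le _ (fun P _ => ?_) fun P _ => ?_
        · exact mul_nonneg (h₀ _) (h₀ _)
        · nlinarith [mul_nonneg (h₀ P.1) (h₁ P.2), mul_nonneg (h₁ P.1) (h₀ P.2),
            mul_nonneg (h₁ P.1) (h₁ P.2)]

/-- If every element is avoided with probability more than `γ`, the union of two independent
copies of `X` has larger trace entropies than `X`. -/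
lemma traceEntropy_lt_union {w : ι → ℝ} (hw : ∀ j, 0 ≤ w j) (hsum : ∑ j ∈ s, w j = 1)
    (h : ∀ i, γ < ∑ j ∈ s with ¬i ∈ X j, w j) (S : Finset α) :
    traceEntropy s w X S ≤
        traceEntropy (s ×ˢ s) (fun p => w p.1 * w p.2) (fun p => X p.1 ∪ X p.2) S ∧
      (0 < traceEntropy s w X S → traceEntropy s w X S <
        traceEntropy (s ×ˢ s) (fun p => w p.1 * w p.2) (fun p => X p.1 ∪ X p.2) S) := by
  induction S using Finset.induction_on with
  | empty => simp [traceEntropy, mass, Finset.sum_product, ← Finset.mul_sum, hsum]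
  | insert i S hi ih =>
    rw [traceEntropy_insert _ _ _ hi, traceEntropy_insert _ _ _ hi]
    have hstep := sum_splitEntropy_union_ge s X hw i S
    have hd : 0 ≤ ∑ T ∈ S.powerset, splitEntropy (mass (s.filter fun j => ¬i ∈ X j) w X S T)
        (mass (s.filter fun j => i ∈ X j) w X S T) :=
      Finset.sum_nonneg fun T _ =>
        splitEntropy_nonneg (mass_nonneg _ X hw S T) (mass_nonneg _ X hw S T)
    have hfac : 1 < (1 + γ) * ∑ j ∈ s with ¬i ∈ X j, w j := by
      nlinarith [h i, invGolden_sq, invGolden_gt]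
    set d := ∑ T ∈ S.powerset, splitEntropy (mass (s.filter fun j => ¬i ∈ X j) w X S T)
        (mass (s.filter fun j => i ∈ X j) w X S T)
    rcases hd.eq_or_lt with hd0 | hd0
    · rw [← hd0, mul_zero] at hstep
      rw [← hd0, add_zero]
      exact ⟨by linarith [ih.1], fun hpos => by linarith [ih.2 hpos]⟩
    · have hlt := hstep.trans_lt' (lt_mul_of_one_lt_left hd0 hfac)
      exact ⟨by linarith [ih.1], fun _ => by linarith [ih.1]⟩

end Mass

lemma sum_negMulLog_le_log_card {ι : Type*} (s : Finset ι) (hs : s.Nonempty) (m : ι → ℝ)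
    (hm : ∀ i ∈ s, 0 ≤ m i) (hsum : ∑ i ∈ s, m i = 1) :
    ∑ i ∈ s, negMulLog (m i) ≤ log s.card := by
  have hn : (0 : ℝ) < s.card := by exact_mod_cast hs.card_pos
  have h := concaveOn_negMulLog.le_map_sum (t := s) (w := fun _ => (s.card : ℝ)⁻¹) (p := m)
    (fun _ _ => by positivity) (by simp [hn.ne']) hm
  simp only [smul_eq_mul, ← Finset.mul_sum, hsum, mul_one] at h
  rw [negMulLog, log_inv, neg_mul_neg] at h
  exact le_of_mul_le_mul_left h (by positivity)

end UnionClosed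

open Real UnionClosed in
/-- In any finite union closed family `F` with `|F| ≥ 2`, some element belongs to at least a
`ψ` fraction of the sets, where `ψ = (3 - √5)/2`. -/
theorem union_closed_freq {α : Type*} [DecidableEq α]
    (F : Finset (Finset α)) (hF : 2 ≤ F.card)
    (hUC : ∀ A ∈ F, ∀ B ∈ F, A ∪ B ∈ F) :
    ∃ x : α, ((F.filter fun A => x ∈ A).card : ℝ) ≥
      (3 - Real.sqrt 5) / 2 * (F.card : ℝ) := by
  by_contra! hlt
  have hn : (0 : ℝ) < F.card := by exact_mod_cast (by omega : 0 < F.card)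
  have hne : F.Nonempty := Finset.card_pos.1 (by omega)
  let w : Finset α → ℝ := fun _ => (F.card : ℝ)⁻¹
  have hw : ∀ A, 0 ≤ w A := fun A => by positivity
  have hsum : ∑ A ∈ F, w A = 1 := by simp [w, hn.ne']
  have hG : ∀ A ∈ F, A ∩ F.sup id = A := fun A hA =>
    Finset.inter_eq_left.2 (Finset.le_sup (f := id) hA)
  have havoid : ∀ i, invGolden < ∑ A ∈ F with ¬i ∈ id A, w A := by
    intro i
    have h1 : ((F.filter fun A => i ∈ A).card : ℝ) + (F.filter fun A => ¬i ∈ A).card = F.card := by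
      exact_mod_cast Finset.card_filter_add_card_filter_not (s := F) fun A => i ∈ A
    have h2 := hlt i
    simp only [w, id, Finset.sum_const, nsmul_eq_mul]
    rw [← div_eq_mul_inv, lt_div_iff₀ hn, invGolden]
    linarith
  have hentropy : traceEntropy F w id (F.sup id) = log F.card := by
    have hmass : ∀ T, mass F w id (F.sup id) T = if T ∈ F then (F.card : ℝ)⁻¹ else 0 := by
      intro T
      rw [mass, Finset.filter_congr fun A hA => by rw [id, hG A hA], Finset.filter_eq']
      split_ifs <;> simp [w]
    simp only [traceEntropy, hmass, apply_ite negMulLog, negMulLog_zero]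
    rw [← Finset.sum_filter, Finset.filter_mem_eq_inter, Finset.inter_eq_right.2]
    · simp [negMulLog, hn.ne']
    · exact fun A hA => Finset.mem_powerset.2 (Finset.le_sup (f := id) hA)
  have hunion : traceEntropy (F ×ˢ F) (fun p => w p.1 * w p.2) (fun p => id p.1 ∪ id p.2)
      (F.sup id) ≤ log F.card := by
    have hsub : F ⊆ (F.sup id).powerset :=
      fun A hA => Finset.mem_powerset.2 (Finset.le_sup (f := id) hA)
    have hzero : ∀ T, T ∉ F → mass (F ×ˢ F) (fun p => w p.1 * w p.2)
        (fun p => id p.1 ∪ id p.2) (F.sup id) T = 0 := by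
      intro T hT
      rw [mass, Finset.filter_false_of_mem, Finset.sum_empty]
      rintro p hp rfl
      rw [Finset.mem_product] at hp
      have hp' := hUC _ hp.1 _ hp.2
      exact hT (by rwa [id, id, hG _ hp'])
    rw [traceEntropy, ← Finset.sum_subset hsub fun T _ hT => by rw [hzero T hT, negMulLog_zero]]
    refine sum_negMulLog_le_log_card F hne _
      (fun T _ => mass_nonneg _ _ (fun p => mul_nonneg (hw p.1) (hw p.2)) _ _) ?_
    rw [Finset.sum_subset hsub fun T _ hT => hzero T hT, sum_mass, Finset.sum_product]
    simp only [← Finset.mul_sum, hsum, mul_one]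
  have hpos : 0 < traceEntropy F w id (F.sup id) := by
    rw [hentropy]
    exact log_pos (by exact_mod_cast hF)
  have := (traceEntropy_lt_union F id hw hsum havoid (F.sup id)).2 hpos
  linarith
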